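/- Let g be a finite-dimensional semisimple Lie algebra over a field k of characteristic 0 and (g,A) a compatible pair. Then for every associative k-algebra F one has (g,A)(F) = F ⊗ g + Σ_{k≥2} ( I_{k−1}(F) ⊗ [g, g^k] + [F, I_{k−2}(F)] ⊗ Z_k(g) ), where Z_k(g) = Z(⟨g⟩) ∩ g^k, ⟨g⟩ = Σ_{n≥1} g^n, and Z(⟨g⟩) is the center of the associative subalgebra ⟨g⟩ of A generated by g. -/

import Mathlib

open Submodule TensorProduct

attribute [local instance 100] LieRing.ofAssociativeRing

variable (K : Type*) [Field K]

/-- The span of all products `a * b`, `a ∈ S`, `b ∈ T` (the subspace `S·T`). -/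
def pSpan {R : Type*} [NonUnitalRing R] [Module K R] (S T : Submodule K R) : Submodule K R :=
  Submodule.span K {x | ∃ a ∈ S, ∃ b ∈ T, x = a * b}

/-- The span of all commutators `a * b - b * a`, `a ∈ S`, `b ∈ T` (the subspace `[S, T]`). -/
def bSpan {R : Type*} [NonUnitalRing R] [Module K R] (S T : Submodule K R) : Submodule K R :=
  Submodule.span K {x | ∃ a ∈ S, ∃ b ∈ T, x = a * b - b * a}

/-- The `k`-th commutator space `S^(k)`: `S^(0) = S`, `S^(k) = [S, S^(k-1)]`.
For `S = ⊤` this is the commutator space `F^(k)` of the algebra. -/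
def cSp {R : Type*} [NonUnitalRing R] [Module K R] (S : Submodule K R) : ℕ → Submodule K R
  | 0 => S
  | (k+1) => bSpan K S (cSp S k)

/-- `IklS K S ℓ k` is `I_k^ℓ(R, S)`: the sum of `S^(λ₁) ⋯ S^(λ_ℓ)` over
`λ₁ + ⋯ + λ_ℓ = k`, defined via the recursion `I_k^1 = S^(k)`,
`I_k^ℓ = Σ_{0 ≤ i ≤ k} S^(i) · I_{k-i}^{ℓ-1}`.  The first argument is the
superscript `ℓ`, the second the subscript `k`; the (unused) value at `ℓ = 0` is `⊥`.
For `S = ⊤` this is `I_k^ℓ(F)`. -/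
def IklS {R : Type*} [NonUnitalRing R] [Module K R] (S : Submodule K R) :
    ℕ → ℕ → Submodule K R
  | 0, _ => ⊥
  | 1, k => cSp K S k
  | (ℓ+2), k => ∑ i ∈ Finset.range (k+1), pSpan K (cSp K S i) (IklS S (ℓ+1) (k-i))

/-- `I_k^{≤ℓ}(F) = Σ_{1 ≤ ℓ' ≤ ℓ} I_k^{ℓ'}(F)`. -/
def Ikle {R : Type*} [NonUnitalRing R] [Module K R] (ℓ k : ℕ) : Submodule K R :=
  ∑ ℓ' ∈ Finset.Icc 1 ℓ, IklS K (⊤ : Submodule K R) ℓ' k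

/-- `I_k(F) = Σ_{ℓ ≥ 1} I_k^ℓ(F)`. -/
def Ik (R : Type*) [NonUnitalRing R] [Module K R] (k : ℕ) : Submodule K R :=
  ⨆ ℓ : ℕ, IklS K (⊤ : Submodule K R) (ℓ + 1) k

/-- `g^n`: the span of all products of `n` elements of `g` (set to `⊥` for `n = 0`). -/
def gPow {R : Type*} [NonUnitalRing R] [Module K R] (g : Submodule K R) : ℕ → Submodule K R
  | 0 => ⊥
  | 1 => g
  | (n+2) => pSpan K g (gPow g (n+1))

/-- The Lie subalgebra (under the commutator bracket) generated by a subspace `S`: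
the smallest subspace containing `S` and closed under `(x, y) ↦ x * y - y * x`. -/
def lieGen {R : Type*} [NonUnitalRing R] [Module K R] (S : Submodule K R) : Submodule K R :=
  sInf {T | S ≤ T ∧ ∀ x ∈ T, ∀ y ∈ T, x * y - y * x ∈ T}

/-- The subspace `S ⊗ T` of `F ⊗[K] A`: the span of all pure tensors `f ⊗ a`
with `f ∈ S`, `a ∈ T`. -/
def tSpan {F A : Type*} [AddCommGroup F] [Module K F] [AddCommGroup A] [Module K A]
    (S : Submodule K F) (T : Submodule K A) : Submodule K (F ⊗[K] A) :=
  Submodule.span K {z | ∃ f ∈ S, ∃ a ∈ T, z = f ⊗ₜ[K] a}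

/-- The current Lie algebra `(g, A)(F)`: the Lie subalgebra of `F ⊗ A` (with the
commutator bracket) generated by `F ⊗ g`. -/
def currentLie {F A : Type*} [NonUnitalRing F] [Module K F] [SMulCommClass K F F]
    [IsScalarTower K F F] [Ring A] [Algebra K A] (g : Submodule K A) :
    Submodule K (F ⊗[K] A) :=
  lieGen K (tSpan K (⊤ : Submodule K F) g)

section Weyl

open LieAlgebra LieModule Module

variable {k L V : Type*} [Field k] [LieRing L] [LieAlgebra k L]
  [AddCommGroup V] [Module k V] [LieRingModule L V] [LieModule k L V]

/-- A semisimple Lie algebra is perfect. -/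
theorem LieAlgebra.IsSemisimple.lie_top_eq_top [IsSemisimple k L] :
    ⁅(⊤ : LieIdeal k L), (⊤ : LieIdeal k L)⁆ = ⊤ := by
  obtain ⟨J, hJ⟩ := exists_isCompl ⁅(⊤ : LieIdeal k L), (⊤ : LieIdeal k L)⁆
  have hJJ : ⁅J, J⁆ = ⊥ :=
    le_bot_iff.mp <| (le_inf (LieSubmodule.mono_lie le_top le_top)
      (LieSubmodule.lie_le_left J J)).trans hJ.disjoint.le_bot
  have : IsLieAbelian J := (LieSubmodule.lie_abelian_iff_lie_self_eq_bot J).mpr hJJ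
  have hJbot : J = ⊥ := (hasTrivialRadical_iff_no_abelian_ideals k L).mp inferInstance J this
  simpa [hJbot] using! hJ.sup_eq_top

/-- A module over a perfect Lie algebra satisfies `LV = L(LV)`. -/
theorem LieModule.lie_top_lie_top_of_perfect
    (hL : ⁅(⊤ : LieIdeal k L), (⊤ : LieIdeal k L)⁆ = ⊤) (N : LieSubmodule k L V) :
    ⁅(⊤ : LieIdeal k L), ⁅(⊤ : LieIdeal k L), N⁆⁆ = ⁅(⊤ : LieIdeal k L), N⁆ := by
  refine le_antisymm (LieSubmodule.lie_le_right _ _) ?_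
  rw [LieSubmodule.lie_le_iff]
  intro x hx m hm
  have mem_lie (y : L) {v : V} {N' : LieSubmodule k L V} (hv : v ∈ N') :
      ⁅y, v⁆ ∈ ⁅(⊤ : LieIdeal k L), N'⁆ := LieSubmodule.lie_mem_lie (LieSubmodule.mem_top y) hv
  rw [← hL, ← LieSubmodule.mem_toSubmodule, LieSubmodule.lieIdeal_oper_eq_linear_span'] at hx
  induction hx using Submodule.span_induction with
  | mem x h =>
    obtain ⟨a, -, b, -, rfl⟩ := h
    rw [lie_lie]
    exact sub_mem (mem_lie a (mem_lie b hm)) (mem_lie b (mem_lie a hm))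
  | zero => simp
  | add x y _ _ hx hy => rw [add_lie]; exact add_mem hx hy
  | smul t x _ hx => rw [smul_lie]; exact SMulMemClass.smul_mem t hx

theorem LieModule.lie_top_eq_bot_of_isNilpotent
    (hL : ⁅(⊤ : LieIdeal k L), (⊤ : LieIdeal k L)⁆ = ⊤) [IsNilpotent L V] :
    ⁅(⊤ : LieIdeal k L), (⊤ : LieSubmodule k L V)⁆ = ⊥ := by
  obtain ⟨n, hn⟩ := (isNilpotent_iff k L V).mp inferInstance
  have key : ∀ n, lowerCentralSeries k L V (n + 1) =
      ⁅(⊤ : LieIdeal k L), (⊤ : LieSubmodule k L V)⁆ := by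
    intro n
    induction n with
    | zero => simp [lowerCentralSeries_succ]
    | succ n ih => rw [lowerCentralSeries_succ, ih, lie_top_lie_top_of_perfect hL]
  rw [← key n, lowerCentralSeries_succ, hn, LieSubmodule.lie_bot]

/-- If the trace form of a finite-dimensional module over a semisimple Lie algebra vanishes,
then the module is trivial. -/
theorem LieModule.lie_top_eq_bot_of_traceForm_eq_zero [CharZero k] [FiniteDimensional k V]
    [IsSemisimple k L] (h : traceForm k L V = 0) :
    ⁅(⊤ : LieIdeal k L), (⊤ : LieSubmodule k L V)⁆ = ⊥ := by
  have hL := IsSemisimple.lie_top_eq_top (k := k) (L := L)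
  have hn := isNilpotent_derivedSeries_of_traceForm_eq_zero h
  have : IsNilpotent L V := by
    rw [isNilpotent_iff_forall' (R := k)] at hn ⊢
    exact fun x ↦ hn ⟨x, by simp [hL]⟩
  exact lie_top_eq_bot_of_isNilpotent hL

/-- The Casimir endomorphism attached to families `b`, `b'` in `L`. -/
noncomputable def LieModule.casimir (V : Type*) [AddCommGroup V] [Module k V] [LieRingModule L V]
    [LieModule k L V] {ι : Type*} [Fintype ι] (b b' : ι → L) : Module.End k V :=
  ∑ i, toEnd k L V (b i) * toEnd k L V (b' i)

theorem LieModule.casimir_apply {ι : Type*} [Fintype ι] (b b' : ι → L) (v : V) :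
    casimir (k := k) V b b' v = ∑ i, ⁅b i, ⁅b' i, v⁆⁆ := by
  simp [casimir]

theorem LieModule.trace_casimir {ι : Type*} [Fintype ι] (b b' : ι → L) :
    LinearMap.trace k V (casimir V b b') = ∑ i, traceForm k L V (b i) (b' i) := by
  simp [casimir, traceForm_apply_apply, Module.End.mul_eq_comp]

/-- The Casimir endomorphism attached to dual bases of an ideal for the (nondegenerate) trace form
commutes with the action of `L`. -/
theorem LieModule.casimir_lie {ι : Type*} [Fintype ι] {J : LieIdeal k L}
    (b b' : ι → J)
    (hb : ∀ x : J, x = ∑ j, traceForm k L V x (b' j) • b j)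
    (hb' : ∀ x : J, x = ∑ j, traceForm k L V x (b j) • b' j) (y : L) (v : V) :
    casimir (k := k) V (fun i ↦ (b i : L)) (fun i ↦ (b' i : L)) ⁅y, v⁆ =
      ⁅y, casimir (k := k) V (fun i ↦ (b i : L)) (fun i ↦ (b' i : L)) v⁆ := by
  have h1 : ∀ i, ⁅y, (b i : L)⁆ = ∑ j, traceForm k L V ⁅y, (b i : L)⁆ (b' j) • (b j : L) := by
    intro i
    have := congrArg (Subtype.val) (hb ⁅y, b i⁆)
    simpa using this
  have h2 : ∀ i, ⁅y, (b' i : L)⁆ = ∑ j, traceForm k L V ⁅y, (b' i : L)⁆ (b j) • (b' j : L) := by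
    intro i
    have := congrArg (Subtype.val) (hb' ⁅y, b' i⁆)
    simpa using this
  have h3 : ∀ i j, traceForm k L V ⁅y, (b' i : L)⁆ (b j) =
      - traceForm k L V ⁅y, (b j : L)⁆ (b' i) := by
    intro i j
    rw [← lie_skew, map_neg, LinearMap.neg_apply, traceForm_apply_lie_apply, traceForm_comm]
  have h4 : ∑ i, (⁅⁅y, (b i : L)⁆, ⁅(b' i : L), v⁆⁆ + ⁅(b i : L), ⁅⁅y, (b' i : L)⁆, v⁆⁆) = 0 := by
    simp_rw [Finset.sum_add_distrib]
    have e1 : ∑ i, ⁅⁅y, (b i : L)⁆, ⁅(b' i : L), v⁆⁆ =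
        ∑ i, ∑ j, traceForm k L V ⁅y, (b i : L)⁆ (b' j) • ⁅(b j : L), ⁅(b' i : L), v⁆⁆ := by
      refine Finset.sum_congr rfl fun i _ ↦ ?_
      conv_lhs => rw [h1 i]
      simp [sum_lie]
    have e2 : ∑ i, ⁅(b i : L), ⁅⁅y, (b' i : L)⁆, v⁆⁆ =
        ∑ i, ∑ j, - (traceForm k L V ⁅y, (b j : L)⁆ (b' i) • ⁅(b i : L), ⁅(b' j : L), v⁆⁆) := by
      refine Finset.sum_congr rfl fun i _ ↦ ?_
      conv_lhs => rw [h2 i]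
      simp [sum_lie, lie_sum, h3]
    rw [e1, e2, Finset.sum_comm, ← Finset.sum_add_distrib]
    simp
  have h5 : ∀ i, ⁅y, ⁅(b i : L), ⁅(b' i : L), v⁆⁆⁆ = ⁅(b i : L), ⁅(b' i : L), ⁅y, v⁆⁆⁆ +
      (⁅⁅y, (b i : L)⁆, ⁅(b' i : L), v⁆⁆ + ⁅(b i : L), ⁅⁅y, (b' i : L)⁆, v⁆⁆) := by
    intro i
    rw [leibniz_lie y, leibniz_lie y, lie_add]
    abel
  rw [casimir_apply, casimir_apply, lie_sum, Finset.sum_congr rfl fun i _ ↦ h5 i,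
    Finset.sum_add_distrib, h4, add_zero]

/-- A finite-dimensional nontrivial module over a semisimple Lie algebra has a non-nilpotent
endomorphism with values in `LV`. -/
theorem LieModule.exists_hom_not_isNilpotent [CharZero k] [FiniteDimensional k L]
    [FiniteDimensional k V] [IsSemisimple k L]
    (h : ⁅(⊤ : LieIdeal k L), (⊤ : LieSubmodule k L V)⁆ ≠ ⊥) :
    ∃ c : V →ₗ⁅k,L⁆ V, (∀ v, c v ∈ ⁅(⊤ : LieIdeal k L), (⊤ : LieSubmodule k L V)⁆) ∧
      ¬ _root_.IsNilpotent (c : Module.End k V) := by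
  classical
  have hinv : (traceForm k L V).lieInvariant L := traceForm_lieInvariant k L V
  let I : LieIdeal k L := InvariantForm.orthogonal (traceForm k L V) hinv ⊤
  have hI (y : L) : y ∈ I ↔ ∀ x, traceForm k L V x y = 0 := by
    simp [I, InvariantForm.mem_orthogonal]
  obtain ⟨J, hJ⟩ := exists_isCompl I
  have hJbot : J ≠ ⊥ := by
    rintro rfl
    have hItop : I = ⊤ := by simpa using! hJ.sup_eq_top
    refine h (lie_top_eq_bot_of_traceForm_eq_zero (LinearMap.ext₂ fun x y ↦ ?_))
    exact (hI y).mp (hItop ▸ LieSubmodule.mem_top y) x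
  let B : LinearMap.BilinForm k J := (traceForm k L V).restrict J.toSubmodule
  have hBapp (x y : J) : B x y = traceForm k L V x y := rfl
  have hsymm : B.IsSymm := ⟨fun x y ↦ traceForm_comm k L V x y⟩
  have hB : B.Nondegenerate := by
    refine (LinearMap.BilinForm.IsSymm.isRefl hsymm).nondegenerate_iff_separatingRight.mpr ?_
    intro y hy
    have : (y : L) ∈ I := by
      rw [hI]
      intro x
      have hx : x ∈ I ⊔ J := hJ.sup_eq_top ▸ LieSubmodule.mem_top x
      obtain ⟨x₁, hx₁, x₂, hx₂, rfl⟩ := (LieSubmodule.mem_sup _ _ _).mp hx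
      rw [map_add, LinearMap.add_apply, traceForm_comm, (hI x₁).mp hx₁, zero_add]
      exact hy ⟨x₂, hx₂⟩
    have : (y : L) ∈ I ⊓ J := ⟨this, y.2⟩
    rw [hJ.inf_eq_bot] at this
    exact Subtype.ext this
  let b := Module.finBasis k J
  let b' := B.dualBasis hB b
  have hb' (x : J) : x = ∑ j, traceForm k L V x (b j) • b' j := by
    conv_lhs => rw [← b'.sum_repr x]
    simp only [b', LinearMap.BilinForm.dualBasis_repr_apply, hBapp]
  have hdual (i j) : B (b i) (b' j) = if i = j then 1 else 0 :=
    LinearMap.BilinForm.apply_dualBasis_right hB hsymm b i j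
  have hb (x : J) : x = ∑ j, traceForm k L V x (b' j) • b j := by
    have : ∀ j, B x (b' j) = b.repr x j := by
      intro j
      conv_lhs => rw [← b.sum_repr x]
      simp only [map_sum, map_smul, LinearMap.sum_apply, LinearMap.smul_apply, hdual, smul_eq_mul,
        mul_ite, mul_one, mul_zero, Finset.sum_ite_eq', Finset.mem_univ, if_true]
    conv_lhs => rw [← b.sum_repr x]
    simp only [← this, hBapp]
  let c : V →ₗ⁅k,L⁆ V :=
    { casimir (k := k) V (fun i ↦ (b i : L)) (fun i ↦ (b' i : L)) with
      map_lie' := fun {x m} ↦ casimir_lie b b' hb hb' x m }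
  refine ⟨c, fun v ↦ ?_, fun hnil ↦ ?_⟩
  · change casimir (k := k) V _ _ v ∈ _
    rw [casimir_apply]
    exact sum_mem fun i _ ↦ LieSubmodule.lie_mem_lie (LieSubmodule.mem_top _)
      (LieSubmodule.mem_top _)
  · have h0 : LinearMap.trace k V (casimir (k := k) V (fun i ↦ (b i : L)) (fun i ↦ (b' i : L))) = 0 :=
      (LinearMap.isNilpotent_trace_of_isNilpotent hnil).eq_zero
    rw [trace_casimir] at h0
    simp_rw [← hBapp, hdual] at h0
    simp only [if_true, Finset.sum_const, Finset.card_univ, Fintype.card_fin, nsmul_eq_mul,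
      mul_one, Nat.cast_eq_zero] at h0
    exact hJbot ((LieSubmodule.toSubmodule_eq_bot J).mp (Submodule.finrank_eq_zero.mp h0))

/-- A finite-dimensional module `V` over a semisimple Lie algebra in characteristic zero is the
sum of `LV` and its submodule of invariants. -/
theorem LieModule.lie_top_sup_maxTrivSubmodule [CharZero k] [FiniteDimensional k L]
    [FiniteDimensional k V] [IsSemisimple k L] :
    ⁅(⊤ : LieIdeal k L), (⊤ : LieSubmodule k L V)⁆ ⊔ maxTrivSubmodule k L V = ⊤ := by
  induction hd : finrank k V using Nat.strong_induction_on generalizing V with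
  | _ d ih =>
  by_cases h : ⁅(⊤ : LieIdeal k L), (⊤ : LieSubmodule k L V)⁆ = ⊥
  · rw [eq_top_iff]
    exact ((LieModule.le_max_triv_iff_bracket_eq_bot k L V).mpr h).trans le_sup_right
  obtain ⟨c, hc, hnil⟩ := exists_hom_not_isNilpotent h
  obtain ⟨n, hn⟩ := Filter.eventually_atTop.mp
    (LinearMap.eventually_isCompl_ker_pow_range_pow (c : Module.End k V))
  specialize hn (n + 1) (Nat.le_succ n)
  let N : LieSubmodule k L V :=
    { LinearMap.ker ((c : Module.End k V) ^ (n + 1)) with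
      lie_mem := by
        intro x m hm
        have hcomm : ∀ (p : ℕ) (m : V),
            ((c : Module.End k V) ^ p) ⁅x, m⁆ = ⁅x, ((c : Module.End k V) ^ p) m⁆ := by
          intro p
          induction p with
          | zero => simp
          | succ p ih => intro m; simp [pow_succ, ih]
        have hm' : ((c : Module.End k V) ^ (n + 1)) m = 0 := hm
        change ((c : Module.End k V) ^ (n + 1)) ⁅x, m⁆ = 0
        rw [hcomm, hm', lie_zero] }
  have hNlt : finrank k N < d := by
    rw [← hd]
    refine Submodule.finrank_lt (s := N.toSubmodule) (fun htop ↦ hnil ⟨n + 1, ?_⟩)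
    exact LinearMap.ker_eq_top.mp htop
  rw [eq_top_iff]
  intro v _
  have hv : v ∈ LinearMap.ker ((c : Module.End k V) ^ (n + 1)) ⊔
      LinearMap.range ((c : Module.End k V) ^ (n + 1)) := hn.sup_eq_top ▸ Submodule.mem_top
  obtain ⟨v₁, hv₁, v₂, ⟨w, rfl⟩, rfl⟩ := Submodule.mem_sup.mp hv
  refine add_mem ?_ (LieSubmodule.mem_sup_left ?_)
  · have := ih _ hNlt (V := N) rfl
    have hmem : (⟨v₁, hv₁⟩ : N) ∈ ⁅(⊤ : LieIdeal k L), (⊤ : LieSubmodule k L N)⁆ ⊔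
        maxTrivSubmodule k L N := by
      rw [this]; exact LieSubmodule.mem_top _
    obtain ⟨a, ha, t, ht, hat⟩ := (LieSubmodule.mem_sup _ _ _).mp hmem
    have hval : v₁ = (a : V) + t := (congrArg Subtype.val hat).symm
    rw [hval]
    refine add_mem (LieSubmodule.mem_sup_left ?_) (LieSubmodule.mem_sup_right ?_)
    · have : N.incl a ∈ LieSubmodule.map N.incl ⁅(⊤ : LieIdeal k L), (⊤ : LieSubmodule k L N)⁆ :=
        LieSubmodule.mem_map_of_mem ha
      rw [LieSubmodule.map_bracket_eq] at this
      exact LieSubmodule.mono_lie_right _ le_top this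
    · rw [mem_maxTrivSubmodule] at ht ⊢
      exact fun x ↦ congrArg Subtype.val (ht x)
  · rw [pow_succ']
    exact hc _

end Weyl

section Spans

variable {k R : Type*} [Field k] [NonUnitalRing R] [Module k R]

theorem mul_mem_pSpan {S T : Submodule k R} {a b : R} (ha : a ∈ S) (hb : b ∈ T) :
    a * b ∈ pSpan k S T :=
  subset_span ⟨a, ha, b, hb, rfl⟩

theorem pSpan_le {S T U : Submodule k R} : pSpan k S T ≤ U ↔ ∀ a ∈ S, ∀ b ∈ T, a * b ∈ U := by
  refine span_le.trans ⟨fun h a ha b hb ↦ h ⟨a, ha, b, hb, rfl⟩, ?_⟩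
  rintro h _ ⟨a, ha, b, hb, rfl⟩
  exact h a ha b hb

theorem comm_mem_bSpan {S T : Submodule k R} {a b : R} (ha : a ∈ S) (hb : b ∈ T) :
    a * b - b * a ∈ bSpan k S T :=
  subset_span ⟨a, ha, b, hb, rfl⟩

theorem bSpan_le {S T U : Submodule k R} :
    bSpan k S T ≤ U ↔ ∀ a ∈ S, ∀ b ∈ T, a * b - b * a ∈ U := by
  refine span_le.trans ⟨fun h a ha b hb ↦ h ⟨a, ha, b, hb, rfl⟩, ?_⟩
  rintro h _ ⟨a, ha, b, hb, rfl⟩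
  exact h a ha b hb

theorem bSpan_mono {S S' T T' : Submodule k R} (hS : S ≤ S') (hT : T ≤ T') :
    bSpan k S T ≤ bSpan k S' T' :=
  bSpan_le.mpr fun _ ha _ hb ↦ comm_mem_bSpan (hS ha) (hT hb)

theorem tmul_mem_tSpan {F A : Type*} [AddCommGroup F] [Module k F] [AddCommGroup A] [Module k A]
    {S : Submodule k F} {T : Submodule k A} {f : F} {a : A} (hf : f ∈ S) (ha : a ∈ T) :
    f ⊗ₜ[k] a ∈ tSpan k S T :=
  subset_span ⟨f, hf, a, ha, rfl⟩

theorem tSpan_le {F A : Type*} [AddCommGroup F] [Module k F] [AddCommGroup A] [Module k A]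
    {S : Submodule k F} {T : Submodule k A} {U : Submodule k (F ⊗[k] A)} :
    tSpan k S T ≤ U ↔ ∀ f ∈ S, ∀ a ∈ T, f ⊗ₜ[k] a ∈ U := by
  refine span_le.trans ⟨fun h a ha b hb ↦ h ⟨a, ha, b, hb, rfl⟩, ?_⟩
  rintro h _ ⟨a, ha, b, hb, rfl⟩
  exact h a ha b hb

theorem le_lieGen (S : Submodule k R) : S ≤ lieGen k S :=
  le_sInf fun _ hT ↦ hT.1

theorem lieGen_comm_mem {S : Submodule k R} {x y : R} (hx : x ∈ lieGen k S)
    (hy : y ∈ lieGen k S) : x * y - y * x ∈ lieGen k S := by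
  rw [lieGen, mem_sInf] at hx hy ⊢
  exact fun T hT ↦ hT.2 x (hx T hT) y (hy T hT)

end Spans

section CommutatorFiltration

variable {k F : Type*} [Field k] [NonUnitalRing F] [Module k F]

theorem comm_mem_cSp (f : F) {i : ℕ} {u : F} (hu : u ∈ cSp k (⊤ : Submodule k F) i) :
    f * u - u * f ∈ cSp k (⊤ : Submodule k F) (i + 1) :=
  comm_mem_bSpan mem_top hu

theorem cSp_succ_le (i : ℕ) :
    cSp k (⊤ : Submodule k F) (i + 1) ≤ cSp k (⊤ : Submodule k F) i := by
  induction i with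
  | zero => exact le_top
  | succ i ih => exact bSpan_mono le_rfl ih

theorem mul_mem_IklS {ℓ i j : ℕ} {u w : F} (hu : u ∈ cSp k (⊤ : Submodule k F) i)
    (hw : w ∈ IklS k (⊤ : Submodule k F) (ℓ + 1) j) :
    u * w ∈ IklS k (⊤ : Submodule k F) (ℓ + 2) (i + j) := by
  have hle := Finset.single_le_sum_of_canonicallyOrdered
    (f := fun i' ↦ pSpan k (cSp k (⊤ : Submodule k F) i')
      (IklS k (⊤ : Submodule k F) (ℓ + 1) (i + j - i')))
    (Finset.mem_range.mpr (Nat.lt_succ_of_le (Nat.le_add_right i j)))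
  refine hle (mul_mem_pSpan hu ?_)
  rwa [Nat.add_sub_cancel_left]

theorem IklS_le {ℓ n : ℕ} {T : Submodule k F}
    (h : ∀ i j, i + j = n → ∀ u ∈ cSp k (⊤ : Submodule k F) i,
      ∀ w ∈ IklS k (⊤ : Submodule k F) (ℓ + 1) j, u * w ∈ T) :
    IklS k (⊤ : Submodule k F) (ℓ + 2) n ≤ T := by
  refine Finset.sum_induction _ (· ≤ T) (fun _ _ ↦ sup_le) bot_le fun i hi ↦ ?_
  have := Finset.mem_range.mp hi
  exact pSpan_le.mpr (h i (n - i) (by omega))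

theorem IklS_le_Ik (ℓ n : ℕ) : IklS k (⊤ : Submodule k F) (ℓ + 1) n ≤ Ik k F n :=
  le_iSup (fun ℓ ↦ IklS k (⊤ : Submodule k F) (ℓ + 1) n) ℓ

theorem mem_Ik_zero (f : F) : f ∈ Ik k F 0 :=
  IklS_le_Ik 0 0 (mem_top : f ∈ (⊤ : Submodule k F))

theorem comm_mem_IklS [SMulCommClass k F F] [IsScalarTower k F F] (f : F) {ℓ n : ℕ} {w : F}
    (hw : w ∈ IklS k (⊤ : Submodule k F) (ℓ + 1) n) :
    f * w - w * f ∈ IklS k (⊤ : Submodule k F) (ℓ + 1) (n + 1) := by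
  induction ℓ generalizing n w with
  | zero => exact comm_mem_cSp f hw
  | succ ℓ ih =>
    refine IklS_le (T := (IklS k (⊤ : Submodule k F) (ℓ + 2) (n + 1)).comap
      (LinearMap.mulLeft k f - LinearMap.mulRight k f)) ?_ hw
    rintro i j rfl u hu w hw
    have h : f * (u * w) - u * w * f = (f * u - u * f) * w + u * (f * w - w * f) := by
      noncomm_ring
    have h1 := mul_mem_IklS (comm_mem_cSp f hu) hw
    rw [Nat.add_right_comm] at h1
    have h2 : u * (f * w - w * f) ∈ IklS k (⊤ : Submodule k F) (ℓ + 2) (i + j + 1) :=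
      mul_mem_IklS (j := j + 1) hu (ih hw)
    simpa [h] using! add_mem h1 h2

theorem IklS_succ_le (ℓ n : ℕ) :
    IklS k (⊤ : Submodule k F) (ℓ + 1) (n + 1) ≤ IklS k (⊤ : Submodule k F) (ℓ + 1) n := by
  induction ℓ generalizing n with
  | zero => exact cSp_succ_le n
  | succ ℓ ih =>
    refine IklS_le fun i j hij u hu w hw ↦ ?_
    cases j with
    | zero =>
      obtain rfl : i = n + 1 := hij
      exact mul_mem_IklS (j := 0) (cSp_succ_le n hu) hw
    | succ j =>
      obtain rfl : i + j = n := Nat.succ_injective hij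
      exact mul_mem_IklS hu (ih j hw)

theorem Ik_succ_le (n : ℕ) : Ik k F (n + 1) ≤ Ik k F n :=
  iSup_mono fun ℓ ↦ IklS_succ_le ℓ n

variable [SMulCommClass k F F]

theorem mul_mem_Ik (f : F) {n : ℕ} {w : F} (hw : w ∈ Ik k F n) : f * w ∈ Ik k F n := by
  suffices Ik k F n ≤ (Ik k F n).comap (LinearMap.mulLeft k f) from this hw
  refine iSup_le fun ℓ w hw ↦ IklS_le_Ik (ℓ + 1) n ?_
  have := mul_mem_IklS (i := 0) (u := f) mem_top hw
  rwa [Nat.zero_add] at this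

theorem comm_mem_Ik [IsScalarTower k F F] (f : F) {n : ℕ} {w : F} (hw : w ∈ Ik k F n) :
    f * w - w * f ∈ Ik k F (n + 1) := by
  suffices Ik k F n ≤ (Ik k F (n + 1)).comap (LinearMap.mulLeft k f - LinearMap.mulRight k f) from
    this hw
  exact iSup_le fun ℓ w hw ↦ IklS_le_Ik ℓ (n + 1) (comm_mem_IklS f hw)

/-- A left ideal containing `[F, I_n]` contains `I_{n+1}`. -/
theorem Ik_succ_le_of_bSpan_le [IsScalarTower k F F] {n : ℕ} {T : Submodule k F}
    (h : bSpan k ⊤ (Ik k F n) ≤ T) (hT : ∀ f, ∀ t ∈ T, f * t ∈ T) : Ik k F (n + 1) ≤ T := by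
  refine iSup_le fun ℓ ↦ ?_
  induction ℓ with
  | zero => exact (bSpan_mono le_rfl (IklS_le_Ik 0 n)).trans h
  | succ ℓ ih =>
    refine IklS_le fun i ↦ ?_
    induction i with
    | zero =>
      intro j hj u _ w hw
      rw [Nat.zero_add] at hj
      exact hT u w (ih (hj ▸ hw))
    | succ i ihi =>
      intro j hij u hu w hw
      refine bSpan_le (U := T.comap (LinearMap.mulRight k w)).mpr (fun f _ u hu ↦ ?_) hu
      have hsplit : (f * u - u * f) * w = (f * (u * w) - u * w * f) - u * (f * w - w * f) := by
        noncomm_ring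
      change (f * u - u * f) * w ∈ T
      rw [hsplit]
      refine sub_mem (h (comm_mem_bSpan mem_top (IklS_le_Ik (ℓ + 1) n ?_)))
        (ihi (j + 1) (by omega) u hu _ (comm_mem_IklS f hw))
      obtain rfl : i + j = n := by omega
      exact mul_mem_IklS hu hw

end CommutatorFiltration

section Powers

variable {k A : Type*} [Field k] [Ring A] [Algebra k A] {g : Submodule k A}

theorem gPow_succ_eq_pow (g : Submodule k A) (n : ℕ) : gPow k g (n + 1) = g ^ (n + 1) := by
  induction n with
  | zero => exact (pow_one g).symm
  | succ n ih =>
    rw [pow_succ', ← ih]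
    exact le_antisymm (pSpan_le.mpr fun _ ha _ hb ↦ mul_mem_mul ha hb)
      (mul_le.mpr fun _ ha _ hb ↦ mul_mem_pSpan ha hb)

theorem comm_mem_pow (hg : ∀ x ∈ g, ∀ y ∈ g, x * y - y * x ∈ g) {x : A} (hx : x ∈ g) {n : ℕ}
    {a : A} (ha : a ∈ g ^ n) : x * a - a * x ∈ g ^ n := by
  induction n generalizing a with
  | zero =>
    obtain ⟨t, rfl⟩ := mem_one.mp (pow_zero g ▸ ha)
    simp [Algebra.commutes t x]
  | succ n ih =>
    rw [pow_succ'] at ha ⊢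
    induction ha using Submodule.mul_induction_on' with
    | mem_mul_mem y hy b hb =>
      have h : x * (y * b) - y * b * x = (x * y - y * x) * b + y * (x * b - b * x) := by
        noncomm_ring
      rw [h]
      exact add_mem (mul_mem_mul (hg x hx y hy) hb) (mul_mem_mul hy (ih hb))
    | add a _ b _ ha hb =>
      rw [show x * (a + b) - (a + b) * x = (x * a - a * x) + (x * b - b * x) by noncomm_ring]
      exact add_mem ha hb

theorem pow_comm_pow_mem (hg : ∀ x ∈ g, ∀ y ∈ g, x * y - y * x ∈ g) {p q : ℕ} {a b : A}
    (ha : a ∈ g ^ p) (hb : b ∈ g ^ (q + 1)) : a * b - b * a ∈ g ^ (p + q) := by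
  induction p generalizing a with
  | zero =>
    obtain ⟨t, rfl⟩ := mem_one.mp (pow_zero g ▸ ha)
    simp [Algebra.commutes t b]
  | succ p ih =>
    rw [pow_succ'] at ha
    induction ha using Submodule.mul_induction_on' with
    | mem_mul_mem y hy a ha =>
      have h : y * a * b - b * (y * a) = y * (a * b - b * a) + (y * b - b * y) * a := by
        noncomm_ring
      rw [h]
      refine add_mem ?_ ?_
      · rw [Nat.add_right_comm, pow_succ']
        exact mul_mem_mul hy (ih ha)
      · rw [show p + 1 + q = q + 1 + p by omega, pow_add]
        exact mul_mem_mul (comm_mem_pow hg hy hb) ha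
    | add a _ a' _ ha ha' =>
      rw [show (a + a') * b - b * (a + a') = (a * b - b * a) + (a' * b - b * a') by noncomm_ring]
      exact add_mem ha ha'

/-- Modulo `[g, g ^ (m + n)] g + g ^ (m + n)`, the products `[h, e] a` and `e [h, a]` are
proportional. -/
theorem smul_comm_mul_add_smul_mul_comm_mem (hg : ∀ x ∈ g, ∀ y ∈ g, x * y - y * x ∈ g) {h : A}
    (hh : h ∈ g) {m n : ℕ} {e a : A} (he : e ∈ g ^ m) (ha : a ∈ g ^ (n + 1)) :
    ((n + 1 : ℕ) : k) • ((h * e - e * h) * a) + (n : k) • (e * (h * a - a * h)) ∈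
      bSpan k g (g ^ (m + n)) * g ⊔ g ^ (m + n) := by
  induction n generalizing m e a with
  | zero =>
    rw [zero_add, pow_one] at ha
    simpa using! mem_sup_left (mul_mem_mul (comm_mem_bSpan hh he) ha)
  | succ n ih =>
    rw [pow_succ'] at ha
    induction ha using Submodule.mul_induction_on' with
    | mem_mul_mem y hy b hb =>
      have hey : e * y ∈ g ^ (m + 1) := pow_succ g m ▸ mul_mem_mul he hy
      have h1 := ih hey hb
      rw [show m + 1 + n = m + (n + 1) by omega] at h1
      have h2 : (h * (e * b) - e * b * h) * y ∈ bSpan k g (g ^ (m + (n + 1))) * g :=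
        mul_mem_mul (comm_mem_bSpan hh (pow_add g m (n + 1) ▸ mul_mem_mul he hb)) hy
      have h3 : (h * e - e * h) * (y * b - b * y) + e * (y * (h * b - b * h) - (h * b - b * h) * y)
          ∈ g ^ (m + (n + 1)) := by
        rw [pow_add]
        exact add_mem (mul_mem_mul (comm_mem_pow hg hh he) (comm_mem_pow hg hy hb))
          (mul_mem_mul he (comm_mem_pow hg hy (comm_mem_pow hg hh hb)))
      convert add_mem h1 (add_mem (mem_sup_left h2) (mem_sup_right h3)) using 1
      push_cast
      simp only [add_smul, one_smul, mul_sub, sub_mul, smul_sub, mul_assoc]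
      abel
    | add a _ b _ ha hb =>
      convert add_mem ha hb using 1
      simp only [mul_add, add_mul, smul_add, add_sub_add_comm]
      abel

/-- If every element of `g ^ (n + 1)` is a sum of commutators and of an element commuting with `g`,
then `g ^ (n + 2)` is spanned by `[g, g ^ (n + 1)] g` and `g ^ (n + 1)`. -/
theorem pow_succ_le_bSpan_mul_sup [CharZero k] (hg : ∀ x ∈ g, ∀ y ∈ g, x * y - y * x ∈ g)
    (hperf : g ≤ bSpan k g g) {Z : Submodule k A} (hZ : ∀ z ∈ Z, ∀ x ∈ g, x * z = z * x) {n : ℕ}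
    (hn : g ^ (n + 1) ≤ bSpan k g (g ^ (n + 1)) ⊔ Z ⊓ g ^ (n + 1)) :
    g ^ (n + 2) ≤ bSpan k g (g ^ (n + 1)) * g ⊔ g ^ (n + 1) := by
  rw [pow_succ, mul_le]
  intro a ha x hx
  obtain ⟨c, hc, z, ⟨hzZ, hz⟩, rfl⟩ := mem_sup.mp (hn ha)
  rw [add_mul]
  refine add_mem (mem_sup_left (mul_mem_mul hc hx)) ?_
  rw [← hZ z hzZ x hx]
  refine bSpan_le (U := (bSpan k g (g ^ (n + 1)) * g ⊔ g ^ (n + 1)).comap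
    (LinearMap.mulRight k z)).mpr (fun h hh e he ↦ ?_) (hperf hx)
  have key := smul_comm_mul_add_smul_mul_comm_mem (k := k) hg hh (m := 1) (by rwa [pow_one]) hz
    (e := e)
  rw [hZ z hzZ h hh, sub_self, mul_zero, smul_zero, add_zero, Nat.add_comm 1 n] at key
  change (h * e - e * h) * z ∈ bSpan k g (g ^ (n + 1)) * g ⊔ g ^ (n + 1)
  exact (smul_mem_iff _ (Nat.cast_ne_zero.mpr n.succ_ne_zero)).mp key

end Powers

section CurrentAlgebra

variable {k F A : Type*} [Field k] [NonUnitalRing F] [Module k F] [SMulCommClass k F F]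
  [IsScalarTower k F F] [Ring A] [Algebra k A] {g : Submodule k A}

theorem tmul_comm_tmul (f w : F) (x z : A) :
    (f ⊗ₜ[k] x) * (w ⊗ₜ[k] z) - (w ⊗ₜ[k] z) * (f ⊗ₜ[k] x) =
      (f * w - w * f) ⊗ₜ[k] (z * x) + (f * w) ⊗ₜ[k] (x * z - z * x) := by
  simp only [Algebra.TensorProduct.tmul_mul_tmul, TensorProduct.sub_tmul, TensorProduct.tmul_sub]
  abel

theorem tmul_mem_currentLie (f : F) {x : A} (hx : x ∈ g) : f ⊗ₜ[k] x ∈ currentLie k (F := F) g :=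
  le_lieGen _ (tmul_mem_tSpan mem_top hx)

theorem currentLie_comm_mem {f w : F} {x z : A} (hx : x ∈ g)
    (h : w ⊗ₜ[k] z ∈ currentLie k (F := F) g) :
    (f * w - w * f) ⊗ₜ[k] (z * x) + (f * w) ⊗ₜ[k] (x * z - z * x) ∈ currentLie k (F := F) g :=
  tmul_comm_tmul (k := k) f w x z ▸ lieGen_comm_mem (tmul_mem_currentLie f hx) h

theorem smul_comm_tmul_mul_add_mem_currentLie (hg : ∀ x ∈ g, ∀ y ∈ g, x * y - y * x ∈ g) {n : ℕ}
    {f u : F} (hu : ∀ z ∈ g ^ n, u ⊗ₜ[k] z ∈ currentLie k (F := F) g)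
    (hfu : ∀ z ∈ g ^ n, (f * u - u * f) ⊗ₜ[k] z ∈ currentLie k (F := F) g) {p q : ℕ}
    (hpq : p + q = n) {a b : A} (ha : a ∈ g ^ (p + 1)) (hb : b ∈ g ^ q) :
    ((p + 1 : ℕ) : k) • ((f * u - u * f) ⊗ₜ[k] (b * a)) + (f * u) ⊗ₜ[k] (a * b - b * a) ∈
      currentLie k (F := F) g := by
  induction p generalizing q a b with
  | zero =>
    rw [zero_add, pow_one] at ha
    rw [zero_add] at hpq
    simpa using! currentLie_comm_mem (f := f) ha (hu b (hpq ▸ hb))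
  | succ p ih =>
    rw [pow_succ'] at ha
    induction ha using Submodule.mul_induction_on' with
    | mem_mul_mem y hy a ha =>
      have hby : b * y ∈ g ^ (q + 1) := pow_succ g q ▸ mul_mem_mul hb hy
      have hab : a * b ∈ g ^ n := by
        rw [← hpq, pow_add]
        exact mul_mem_mul ha hb
      have h1 := ih (q := q + 1) (by omega) ha hby
      have h2 := currentLie_comm_mem (f := f) hy (hu _ hab)
      have h3 := hfu (a * (b * y) - b * y * a) (by
        rw [← hpq]
        exact pow_comm_pow_mem hg ha hby)
      convert sub_mem (add_mem h1 h2) h3 using 1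
      push_cast
      simp only [add_smul, one_smul, TensorProduct.sub_tmul, TensorProduct.tmul_sub, mul_assoc]
      abel
    | add a _ a' _ ha ha' =>
      convert add_mem ha ha' using 1
      simp only [mul_add, add_mul, smul_add, add_sub_add_comm, TensorProduct.tmul_add]
      abel

theorem comm_tmul_mem_currentLie [CharZero k] (hg : ∀ x ∈ g, ∀ y ∈ g, x * y - y * x ∈ g) {n : ℕ}
    {f u : F} (hu : ∀ z ∈ g ^ n, u ⊗ₜ[k] z ∈ currentLie k (F := F) g)
    (hfu : ∀ z ∈ g ^ n, (f * u - u * f) ⊗ₜ[k] z ∈ currentLie k (F := F) g) {z : A}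
    (hz : z ∈ g ^ (n + 1)) : (f * u - u * f) ⊗ₜ[k] z ∈ currentLie k (F := F) g := by
  have h := smul_comm_tmul_mul_add_mem_currentLie hg hu hfu (add_zero n) hz
    (b := 1) (by rw [pow_zero]; exact one_le.mp le_rfl)
  rw [one_mul, mul_one, sub_self, TensorProduct.tmul_zero, add_zero] at h
  exact (smul_mem_iff _ (Nat.cast_ne_zero.mpr n.succ_ne_zero)).mp h

/-- The current Lie algebra contains `I_n ⊗ [g, g^{n+1}]` and `[F, I_n] ⊗ g^{n+2}`. -/
theorem tmul_mem_currentLie_of_mem_Ik [CharZero k] (hg : ∀ x ∈ g, ∀ y ∈ g, x * y - y * x ∈ g)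
    (hpow : ∀ n, g ^ (n + 3) ≤ bSpan k g (g ^ (n + 2)) * g ⊔ g ^ (n + 2)) (n : ℕ) :
    (∀ w ∈ Ik k F n, ∀ z ∈ bSpan k g (g ^ (n + 1)), w ⊗ₜ[k] z ∈ currentLie k (F := F) g) ∧
      ∀ u ∈ bSpan k ⊤ (Ik k F n), ∀ z ∈ g ^ (n + 2), u ⊗ₜ[k] z ∈ currentLie k (F := F) g := by
  induction n with
  | zero =>
    have hbr : bSpan k g (g ^ 1) ≤ g := by
      rw [pow_one]
      exact bSpan_le.mpr hg
    refine ⟨fun w _ z hz ↦ tmul_mem_currentLie w (hbr hz), fun u hu z hz ↦ ?_⟩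
    refine bSpan_le (U := (currentLie k (F := F) g).comap
      ((TensorProduct.mk k F A).flip z)).mpr (fun f _ w _ ↦ ?_) hu
    rw [zero_add, pow_two] at hz
    refine mul_le (P := (currentLie k (F := F) g).comap
      (TensorProduct.mk k F A (f * w - w * f))).mpr (fun y hy x hx ↦ ?_) hz
    exact (add_mem_cancel_right (tmul_mem_currentLie _ (hg x hx y hy))).mp
      (currentLie_comm_mem hx (tmul_mem_currentLie w hy))
  | succ n ih =>
    obtain ⟨-, ihB⟩ := ih
    have hA : ∀ w ∈ Ik k F (n + 1), ∀ z ∈ bSpan k g (g ^ (n + 2)),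
        w ⊗ₜ[k] z ∈ currentLie k (F := F) g := by
      have hle : bSpan k ⊤ (Ik k F n) ≤ Ik k F (n + 1) :=
        bSpan_le.mpr fun f _ w hw ↦ comm_mem_Ik f hw
      have hbr : bSpan k g (g ^ (n + 2)) ≤ g ^ (n + 2) :=
        bSpan_le.mpr fun x hx z hz ↦ comm_mem_pow hg hx hz
      intro w hw
      suffices Ik k F (n + 1) ≤ bSpan k ⊤ (Ik k F n) ⊔ pSpan k ⊤ (bSpan k ⊤ (Ik k F n)) by
        intro z hz
        obtain ⟨u, hu, v, hv, rfl⟩ := mem_sup.mp (this hw)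
        rw [TensorProduct.add_tmul]
        refine add_mem (ihB u hu z (hbr hz)) ?_
        refine pSpan_le (U := (currentLie k (F := F) g).comap
          ((TensorProduct.mk k F A).flip z)).mpr (fun f _ u hu ↦ ?_) hv
        refine bSpan_le (U := (currentLie k (F := F) g).comap
          (TensorProduct.mk k F A (f * u))).mpr (fun x hx z hz ↦ ?_) hz
        have hfu : ∀ z ∈ g ^ (n + 2), (f * u - u * f) ⊗ₜ[k] z ∈ currentLie k (F := F) g :=
          ihB _ (comm_mem_bSpan mem_top (Ik_succ_le n (hle hu)))
        refine (add_mem_cancel_left (comm_tmul_mem_currentLie hg (ihB u hu) hfu ?_)).mp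
          (currentLie_comm_mem hx (ihB u hu z hz))
        rw [pow_succ g (n + 2)]
        exact mul_mem_mul hz hx
      refine Ik_succ_le_of_bSpan_le le_sup_left fun f t ht ↦ ?_
      obtain ⟨u, hu, v, hv, rfl⟩ := mem_sup.mp ht
      rw [mul_add]
      refine mem_sup_right (add_mem (mul_mem_pSpan mem_top hu) ?_)
      refine pSpan_le (U := (pSpan k ⊤ (bSpan k ⊤ (Ik k F n))).comap
        (LinearMap.mulLeft k f)).mpr (fun f' _ u hu ↦ ?_) hv
      change f * (f' * u) ∈ pSpan k ⊤ (bSpan k ⊤ (Ik k F n))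
      rw [← mul_assoc]
      exact mul_mem_pSpan mem_top hu
    refine ⟨hA, fun u hu z hz ↦ ?_⟩
    refine bSpan_le (U := (currentLie k (F := F) g).comap
      ((TensorProduct.mk k F A).flip z)).mpr (fun f _ w hw ↦ ?_) hu
    refine sup_le (c := (currentLie k (F := F) g).comap
      (TensorProduct.mk k F A (f * w - w * f))) (mul_le.mpr fun z hz x hx ↦ ?_)
      (fun z hz ↦ ihB _ (comm_mem_bSpan mem_top (Ik_succ_le n hw)) z hz) (hpow n hz)
    have hz' : z ∈ g ^ (n + 2) :=
      bSpan_le.mpr (fun x hx z hz ↦ comm_mem_pow hg hx hz) hz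
    exact (add_mem_cancel_right (hA _ (mul_mem_Ik f hw) _ (comm_mem_bSpan hx hz'))).mp
      (currentLie_comm_mem hx (hA w hw z hz))

/-- To bound the current Lie algebra from above it suffices to consider brackets with generators. -/
theorem currentLie_le {R : Submodule k (F ⊗[k] A)} (hR : tSpan k ⊤ g ≤ R)
    (h : ∀ (f : F), ∀ x ∈ g, ∀ r ∈ R, (f ⊗ₜ[k] x) * r - r * (f ⊗ₜ[k] x) ∈ R) :
    currentLie k (F := F) g ≤ R := by
  let N : Submodule k (F ⊗[k] A) :=
    { carrier := {n | n ∈ R ∧ ∀ r ∈ R, n * r - r * n ∈ R}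
      add_mem' := by
        rintro a b ⟨ha, ha'⟩ ⟨hb, hb'⟩
        refine ⟨add_mem ha hb, fun r hr ↦ ?_⟩
        rw [show (a + b) * r - r * (a + b) = (a * r - r * a) + (b * r - r * b) by noncomm_ring]
        exact add_mem (ha' r hr) (hb' r hr)
      zero_mem' := ⟨zero_mem R, fun r _ ↦ by simp⟩
      smul_mem' := by
        rintro t a ⟨ha, ha'⟩
        refine ⟨R.smul_mem t ha, fun r hr ↦ ?_⟩
        rw [smul_mul_assoc, mul_smul_comm, ← smul_sub]
        exact R.smul_mem t (ha' r hr) }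
  have hN : currentLie k (F := F) g ≤ N := by
    refine sInf_le ⟨tSpan_le.mpr fun f hf x hx ↦ ⟨hR (tmul_mem_tSpan hf hx), h f x hx⟩, ?_⟩
    rintro a ⟨ha, ha'⟩ b ⟨hb, hb'⟩
    refine ⟨ha' b hb, fun r hr ↦ ?_⟩
    rw [show (a * b - b * a) * r - r * (a * b - b * a) =
      (a * (b * r - r * b) - (b * r - r * b) * a) - (b * (a * r - r * a) - (a * r - r * a) * b) by
      simp only [mul_sub, sub_mul, mul_assoc]
      abel]
    exact sub_mem (ha' _ (hb' r hr)) (hb' _ (ha' r hr))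
  exact fun x hx ↦ (hN hx).1

/-- The description of the current Lie algebra, assuming that `g` is perfect and that every power
of `g` is the sum of its commutators with `g` and its part in a subspace `Z` commuting with `g`. -/
theorem currentLie_eq_of_perfect [CharZero k] (hg : ∀ x ∈ g, ∀ y ∈ g, x * y - y * x ∈ g)
    (hperf : g ≤ bSpan k g g) {Z : Submodule k A} (hZ : ∀ z ∈ Z, ∀ x ∈ g, x * z = z * x)
    (hpow : ∀ n, g ^ (n + 1) ≤ bSpan k g (g ^ (n + 1)) ⊔ Z ⊓ g ^ (n + 1)) :
    currentLie k (F := F) g = tSpan k (⊤ : Submodule k F) g ⊔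
      ⨆ n : ℕ, (tSpan k (Ik k F (n + 1)) (bSpan k g (g ^ (n + 2))) ⊔
        tSpan k (bSpan k (⊤ : Submodule k F) (Ik k F n)) (Z ⊓ g ^ (n + 2))) := by
  set R := tSpan k (⊤ : Submodule k F) g ⊔
    ⨆ n : ℕ, (tSpan k (Ik k F (n + 1)) (bSpan k g (g ^ (n + 2))) ⊔
      tSpan k (bSpan k (⊤ : Submodule k F) (Ik k F n)) (Z ⊓ g ^ (n + 2))) with hRdef
  apply le_antisymm
  · have hle (n : ℕ) := (le_iSup (fun n : ℕ ↦
      (tSpan k (Ik k F (n + 1)) (bSpan k g (g ^ (n + 2))) ⊔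
        tSpan k (bSpan k (⊤ : Submodule k F) (Ik k F n)) (Z ⊓ g ^ (n + 2)))) n).trans
      (le_sup_right (a := tSpan k (⊤ : Submodule k F) g))
    have h1 {n : ℕ} {w : F} {z : A} (hw : w ∈ Ik k F (n + 1))
        (hz : z ∈ bSpan k g (g ^ (n + 2))) : w ⊗ₜ[k] z ∈ R :=
      hle n (mem_sup_left (tmul_mem_tSpan hw hz))
    have h2 {n : ℕ} {f w : F} {z : A} (hw : w ∈ Ik k F n) (hz : z ∈ g ^ (n + 2)) :
        (f * w - w * f) ⊗ₜ[k] z ∈ R := by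
      obtain ⟨c, hc, z, hz', rfl⟩ := mem_sup.mp (hpow (n + 1) hz)
      rw [TensorProduct.tmul_add]
      exact add_mem (h1 (comm_mem_Ik f hw) hc)
        (hle n (mem_sup_right (tmul_mem_tSpan (comm_mem_bSpan mem_top hw) hz')))
    have h3 {n : ℕ} {f w : F} {x z : A} (hw : w ∈ Ik k F (n + 1)) (hx : x ∈ g)
        (hz : z ∈ g ^ (n + 2)) : (f ⊗ₜ[k] x) * (w ⊗ₜ[k] z) - (w ⊗ₜ[k] z) * (f ⊗ₜ[k] x) ∈ R := by
      rw [tmul_comm_tmul]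
      exact add_mem (h2 hw (pow_succ g (n + 2) ▸ mul_mem_mul hz hx))
        (h1 (mul_mem_Ik f hw) (comm_mem_bSpan hx hz))
    refine currentLie_le le_sup_left fun f x hx ↦ ?_
    suffices R ≤ R.comap (LinearMap.mulLeft k (f ⊗ₜ[k] x) - LinearMap.mulRight k (f ⊗ₜ[k] x)) from
      this
    refine sup_le (tSpan_le.mpr fun w _ y hy ↦ ?_) (iSup_le fun n ↦ sup_le
      (tSpan_le.mpr fun w hw z hz ↦ h3 hw hx ?_) (tSpan_le.mpr fun w hw z hz ↦ h3 ?_ hx hz.2))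
    · change (f ⊗ₜ[k] x) * (w ⊗ₜ[k] y) - (w ⊗ₜ[k] y) * (f ⊗ₜ[k] x) ∈ R
      rw [tmul_comm_tmul]
      exact add_mem (h2 (mem_Ik_zero w) (by rw [zero_add, pow_two]; exact mul_mem_mul hy hx))
        (mem_sup_left (tmul_mem_tSpan mem_top (hg x hx y hy)))
    · exact bSpan_le.mpr (fun x hx z hz ↦ comm_mem_pow hg hx hz) hz
    · exact bSpan_le.mpr (fun f _ w hw ↦ comm_mem_Ik f hw) hw
  · have key := tmul_mem_currentLie_of_mem_Ik (F := F) hg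
      fun n ↦ pow_succ_le_bSpan_mul_sup hg hperf hZ (hpow (n + 1))
    exact sup_le (le_lieGen _) (iSup_le fun n ↦ sup_le (tSpan_le.mpr (key (n + 1)).1)
      (tSpan_le.mpr fun u hu z hz ↦ (key n).2 u hu z hz.2))

end CurrentAlgebra

section Semisimple

open LieModule

variable {k A : Type*} [Field k] [Ring A] [Algebra k A] (L : LieSubalgebra k A)

theorem LieSubalgebra.mul_sub_mul_mem {x y : A} (hx : x ∈ L.toSubmodule) (hy : y ∈ L.toSubmodule) :
    x * y - y * x ∈ L.toSubmodule := by
  rw [← LieRing.of_associative_ring_bracket]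
  exact L.lie_mem hx hy

/-- The powers of `L` in `A` are submodules for the adjoint action. -/
def LieSubalgebra.powLieSubmodule (n : ℕ) : LieSubmodule k L A where
  __ := L.toSubmodule ^ n
  lie_mem {x a} ha := by
    change ⁅(x : A), a⁆ ∈ L.toSubmodule ^ n
    rw [LieRing.of_associative_ring_bracket]
    exact comm_mem_pow (fun _ hx _ hy ↦ L.mul_sub_mul_mem hx hy) x.2 ha

theorem LieSubalgebra.le_bSpan_of_isSemisimple [LieAlgebra.IsSemisimple k L] :
    L.toSubmodule ≤ bSpan k L.toSubmodule L.toSubmodule := by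
  intro x hx
  have h : (⟨x, hx⟩ : L) ∈ ⁅(⊤ : LieIdeal k L), (⊤ : LieIdeal k L)⁆ := by
    rw [LieAlgebra.IsSemisimple.lie_top_eq_top]
    exact LieSubmodule.mem_top _
  rw [← LieSubmodule.mem_toSubmodule, LieSubmodule.lieIdeal_oper_eq_linear_span'] at h
  refine span_le (p := (bSpan k L.toSubmodule L.toSubmodule).comap L.toSubmodule.subtype).mpr
    ?_ h
  rintro _ ⟨y, -, z, -, rfl⟩
  exact comm_mem_bSpan y.2 z.2

theorem LieSubalgebra.pow_le_bSpan_sup [CharZero k] [FiniteDimensional k L]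
    [LieAlgebra.IsSemisimple k L] {n : ℕ} {T : Submodule k A}
    (hT : ∀ a ∈ L.toSubmodule ^ n, (∀ x ∈ L.toSubmodule, x * a = a * x) → a ∈ T) :
    L.toSubmodule ^ n ≤ bSpan k L.toSubmodule (L.toSubmodule ^ n) ⊔ T := by
  have : FiniteDimensional k (L.powLieSubmodule n) :=
    Module.Finite.iff_fg.mpr (Submodule.FG.pow (Module.Finite.iff_fg.mp ‹FiniteDimensional k L›) n)
  intro a ha
  have h : (⟨a, ha⟩ : L.powLieSubmodule n) ∈
      ⁅(⊤ : LieIdeal k L), (⊤ : LieSubmodule k L (L.powLieSubmodule n))⁆ ⊔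
        maxTrivSubmodule k L (L.powLieSubmodule n) := by
    rw [lie_top_sup_maxTrivSubmodule]
    exact LieSubmodule.mem_top _
  obtain ⟨c, hc, z, hz, hcz⟩ := (LieSubmodule.mem_sup _ _ _).mp h
  obtain rfl : (c : A) + z = a := congrArg Subtype.val hcz
  refine add_mem (mem_sup_left ?_) (mem_sup_right (hT z z.2 fun x hx ↦ ?_))
  · rw [← LieSubmodule.mem_toSubmodule, LieSubmodule.lieIdeal_oper_eq_linear_span'] at hc
    refine span_le (p := (bSpan k L.toSubmodule (L.toSubmodule ^ n)).comap
      (L.powLieSubmodule n).toSubmodule.subtype).mpr ?_ hc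
    rintro _ ⟨y, -, z, -, rfl⟩
    exact comm_mem_bSpan y.2 z.2
  · exact sub_eq_zero.mp (congrArg Subtype.val (hz ⟨x, hx⟩))

end Semisimple

/-- for a compatible pair `(g, A)` with `g` finite-dimensional semisimple,
`(g,A)(F) = F ⊗ g + Σ_{k ≥ 2} ( I_{k-1}(F) ⊗ [g, g^k] + [F, I_{k-2}(F)] ⊗ Z_k(g) )`,
where `Z_k(g) = Z(⟨g⟩) ∩ g^k`. -/
theorem statement16 {K : Type*} [Field K] [CharZero K]
    {F : Type*} [NonUnitalRing F] [Module K F] [SMulCommClass K F F] [IsScalarTower K F F]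
    {A : Type*} [Ring A] [Algebra K A]
    (L : LieSubalgebra K A) [FiniteDimensional K L] [LieAlgebra.IsSemisimple K L]
    (Z : Submodule K A)
    (hZ : ∀ x : A, x ∈ Z ↔ x ∈ (⨆ n : ℕ, gPow K L.toSubmodule (n + 1)) ∧
      ∀ y ∈ (⨆ n : ℕ, gPow K L.toSubmodule (n + 1)), x * y = y * x) :
    currentLie K (F := F) L.toSubmodule =
      tSpan K (⊤ : Submodule K F) L.toSubmodule ⊔
        ⨆ k : ℕ,
          (tSpan K (Ik K F (k + 1)) (bSpan K L.toSubmodule (gPow K L.toSubmodule (k + 2))) ⊔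
            tSpan K (bSpan K (⊤ : Submodule K F) (Ik K F k))
              (Z ⊓ gPow K L.toSubmodule (k + 2))) := by
  simp only [gPow_succ_eq_pow] at hZ ⊢
  have hmem (n : ℕ) : L.toSubmodule ^ (n + 1) ≤ ⨆ n : ℕ, L.toSubmodule ^ (n + 1) :=
    le_iSup (fun n ↦ L.toSubmodule ^ (n + 1)) n
  have hL : L.toSubmodule ≤ ⨆ n : ℕ, L.toSubmodule ^ (n + 1) := by
    simpa using hmem 0
  refine currentLie_eq_of_perfect (fun _ hx _ hy ↦ L.mul_sub_mul_mem hx hy)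
    L.le_bSpan_of_isSemisimple (fun z hz x hx ↦ (((hZ z).mp hz).2 x (hL hx)).symm)
    fun n ↦ L.pow_le_bSpan_sup fun a ha hcomm ↦ ⟨(hZ a).mpr ⟨hmem n ha, ?_⟩, ha⟩
  suffices h : ∀ n : ℕ, L.toSubmodule ^ n ≤ (Subalgebra.centralizer K {a}).toSubmodule by
    exact fun y hy ↦ iSup_le (fun n ↦ h (n + 1)) hy a rfl
  intro n
  induction n with
  | zero =>
    rw [pow_zero]
    exact Submodule.one_le.mpr (one_mem (Subalgebra.centralizer K {a}))
  | succ n ih =>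
    rw [pow_succ]
    refine mul_le.mpr fun b hb x hx ↦ mul_mem (S := Subalgebra K A) (ih hb) ?_
    exact Subalgebra.mem_centralizer_iff K |>.mpr fun _ h ↦ h ▸ (hcomm x hx).symm
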